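/- arXiv:2306.11951 — 4 statements merged into one kernel-verified Lean document; each statement's English description precedes it below -/
import Mathlib

section
/- There exists a universal constant C > 0 such that for all K ≥ 1, p ∈ (0,1/2) and δ ∈ (0,1/2), there is an adaptive algorithm (the noisy tournament algorithm) that makes at most C·K·ln(1/δ)/(1−H(p)) noisy queries and outputs OR(θ) correctly with probability at least 1 − 2δ for every θ ∈ {0,1}^K. -/
/-- Binary entropy (in bits): `H(p) = -p log₂ p - (1-p) log₂ (1-p)`. -/
noncomputable def binEnt (p : ℝ) : ℝ :=
  -(p * Real.logb 2 p) - (1 - p) * Real.logb 2 (1 - p)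

/-- The OR of `K` bits. -/
def orFun {K : ℕ} (θ : Fin K → Bool) : Bool := decide (∃ k, θ k = true)

/-- Error probability of a deterministic adaptive `T`-round strategy for computing the
OR of `K` noisy bits when the true bits are `θ` and each observation is flipped
independently with probability `p`. -/
noncomputable def detErrOR (K T : ℕ) (p : ℝ)
    (q : Fin T → (Fin T → Bool) → Fin K)
    (out : (Fin T → Bool) → Bool) (θ : Fin K → Bool) : ℝ :=
  ∑ ys : Fin T → Bool,
    (∏ t : Fin T, if ys t = θ (q t ys) then 1 - p else p) *
      (if out ys = orFun θ then 0 else 1)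

/-- Adaptive query programs over `K` bits returning a value in `α`. -/
inductive QueryProg (K : ℕ) (α : Type) : Type
  | ret (a : α) : QueryProg K α
  | query (k : Fin K) (next : Bool → QueryProg K α) : QueryProg K α

namespace QueryProg

variable {K : ℕ} {α β : Type}

/-- Sequential composition of query programs. -/
def bind : QueryProg K α → (α → QueryProg K β) → QueryProg K β
  | ret a, f => f a
  | query k next, f => query k fun b => (next b).bind f

/-- The program makes at most `n` queries on every run. -/
def DepthLE : QueryProg K α → ℕ → Prop
  | ret _, _ => True
  | query _ _, 0 => False
  | query _ next, n + 1 => ∀ b, (next b).DepthLE n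

/-- Expected value of `f` at the output, when the true bits are `θ` and each observation is
flipped independently with probability `p`. -/
noncomputable def expect (p : ℝ) (θ : Fin K → Bool) : QueryProg K α → (α → ℝ) → ℝ
  | ret a, f => f a
  | query k next, f => ∑ b : Bool, (if b = θ k then 1 - p else p) * (next b).expect p θ f

theorem DepthLE.mono {P : QueryProg K α} {m n : ℕ} (h : P.DepthLE m) (hmn : m ≤ n) :
    P.DepthLE n := by
  induction P generalizing m n with
  | ret a => cases n <;> trivial
  | query k next ih =>
    cases m with
    | zero => exact h.elim
    | succ m =>
      cases n with
      | zero => omega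
      | succ n => exact fun b => ih b (h b) (by omega)

theorem DepthLE.bind {P : QueryProg K α} {f : α → QueryProg K β} {m n : ℕ}
    (hP : P.DepthLE m) (hf : ∀ a, (f a).DepthLE n) : (P.bind f).DepthLE (m + n) := by
  induction P generalizing m with
  | ret a => exact (hf a).mono (by omega)
  | query k next ih =>
    cases m with
    | zero => exact hP.elim
    | succ m =>
      rw [Nat.succ_add]
      exact fun b => ih b (hP b)

theorem expect_bind (p : ℝ) (θ : Fin K → Bool) (P : QueryProg K α) (f : α → QueryProg K β)
    (g : β → ℝ) : (P.bind f).expect p θ g = P.expect p θ fun a => (f a).expect p θ g := by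
  induction P with
  | ret a => rfl
  | query k next ih => simp only [QueryProg.bind, expect, ih]

theorem expect_mono {p : ℝ} (hp0 : 0 ≤ p) (hp1 : p ≤ 1) (θ : Fin K → Bool)
    (P : QueryProg K α) {f g : α → ℝ} (hfg : ∀ a, f a ≤ g a) :
    P.expect p θ f ≤ P.expect p θ g := by
  induction P with
  | ret a => exact hfg a
  | query k next ih =>
    refine Finset.sum_le_sum fun b _ => mul_le_mul_of_nonneg_left (ih b) ?_
    split_ifs <;> linarith

theorem expect_add_const (p : ℝ) (θ : Fin K → Bool) (P : QueryProg K α) (f : α → ℝ) (c : ℝ) :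
    P.expect p θ (fun a => f a + c) = P.expect p θ f + c := by
  induction P with
  | ret a => rfl
  | query k next ih =>
    simp only [expect, ih, Fintype.sum_bool]
    cases θ k <;> simp <;> ring

theorem expect_const (p : ℝ) (θ : Fin K → Bool) (P : QueryProg K α) (c : ℝ) :
    P.expect p θ (fun _ => c) = c := by
  induction P with
  | ret a => rfl
  | query k next ih =>
    simp only [expect, ih, Fintype.sum_bool]
    cases θ k <;> simp <;> ring

/-- Every program of depth at most `T` is realized by a `T`-round adaptive strategy. -/
theorem DepthLE.exists_strategy (k₀ : Fin K) {T : ℕ} {P : QueryProg K α} (hP : P.DepthLE T) :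
    ∃ (q : Fin T → (Fin T → Bool) → Fin K) (out : (Fin T → Bool) → α),
      (∀ (t : Fin T) (ys ys' : Fin T → Bool),
        (∀ s : Fin T, (s : ℕ) < (t : ℕ) → ys s = ys' s) → q t ys = q t ys') ∧
      ∀ (p : ℝ) (θ : Fin K → Bool) (g : α → ℝ),
        ∑ ys : Fin T → Bool,
          (∏ t : Fin T, if ys t = θ (q t ys) then 1 - p else p) * g (out ys) =
        P.expect p θ g := by
  induction T generalizing P with
  | zero =>
    cases P with
    | ret a => exact ⟨fun _ _ => k₀, fun _ => a, fun _ _ _ _ => rfl, by simp [expect]⟩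
    | query k next => exact hP.elim
  | succ T ih =>
    obtain ⟨k, next, hnext, hexp⟩ : ∃ (k : Fin K) (next : Bool → QueryProg K α),
        (∀ b, (next b).DepthLE T) ∧
        ∀ p θ g, (query k next).expect p θ g = P.expect p θ g := by
      cases P with
      | ret a =>
        refine ⟨k₀, fun _ => ret a, fun _ => by cases T <;> trivial, fun p θ g => ?_⟩
        simp only [expect, Fintype.sum_bool]
        cases θ k₀ <;> simp <;> ring
      | query k next => exact ⟨k, next, hP, fun _ _ _ => rfl⟩
    choose q out hq hsum using fun b => ih (hnext b)
    refine ⟨fun t ys => Fin.cases k (fun s => q (ys 0) s (Fin.tail ys)) t,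
      fun ys => out (ys 0) (Fin.tail ys), fun t ys ys' h => ?_, fun p θ g => ?_⟩
    · cases t using Fin.cases with
      | zero => rfl
      | succ t =>
        have h0 : ys 0 = ys' 0 := h 0 (by simp)
        simp only [Fin.cases_succ, h0]
        exact hq _ _ _ _ fun s hs => h s.succ (by simpa using hs)
    · rw [← hexp, ← (Fin.consEquiv fun _ => Bool).sum_comp, Fintype.sum_prod_type]
      simp only [expect, ← hsum, Fin.consEquiv_apply, Fin.prod_univ_succ, Fin.cases_zero,
        Fin.cases_succ, Fin.cons_zero, Fin.cons_succ, Finset.mul_sum, mul_assoc]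
      rfl

/-- Query bit `k` repeatedly, `n` times, and report whether the signed count of answers, started
at `s`, ends up positive. -/
def majority (k : Fin K) : ℕ → ℤ → QueryProg K Bool
  | 0, s => ret (decide (0 < s))
  | n + 1, s => query k fun b => majority k n (s + if b then 1 else -1)

theorem depthLE_majority (k : Fin K) (n : ℕ) (s : ℤ) : (majority k n s).DepthLE n := by
  induction n generalizing s with
  | zero => trivial
  | succ n ih => exact fun b => ih _

theorem expect_majority_le {p : ℝ} (hp0 : 0 < p) (hp1 : p < 1 / 2) (θ : Fin K → Bool)
    (k : Fin K) (n : ℕ) (s : ℤ) :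
    (majority k n s).expect p θ (fun b => if b = θ k then 0 else 1) ≤
      (1 - (1 - 2 * p) ^ 2 / 2) ^ n * (2 * p) ^ (if θ k then s else -s) := by
  have hl : (0 : ℝ) < 2 * p := by linarith
  induction n generalizing s with
  | zero =>
    simp only [majority, expect, pow_zero, one_mul]
    split_ifs with h1 h2 h2
    · positivity
    · positivity
    · refine one_le_zpow_of_nonpos₀ hl (by linarith) ?_
      rw [h2] at h1
      simpa using h1
    · refine one_le_zpow_of_nonpos₀ hl (by linarith) ?_
      have h2' : θ k = false := by simpa using h2
      rw [h2'] at h1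
      have : 0 < s := by simpa using h1
      omega
  | succ n ih =>
    simp only [majority, expect, Fintype.sum_bool]
    have e1 := ih (s + 1)
    have e2 := ih (s + -1)
    cases hk : θ k <;>
      simp only [hk, Bool.false_eq_true, if_true, if_false, reduceCtorEq] at e1 e2 ⊢
    · rw [neg_add, zpow_add₀ hl.ne', zpow_neg_one] at e1
      rw [neg_add, neg_neg, zpow_add₀ hl.ne', zpow_one] at e2
      refine (add_le_add (mul_le_mul_of_nonneg_left e1 hp0.le)
        (mul_le_mul_of_nonneg_left e2 (by linarith : 0 ≤ 1 - p))).trans_eq ?_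
      field_simp
      ring
    · rw [zpow_add₀ hl.ne', zpow_one] at e1
      rw [zpow_add₀ hl.ne', zpow_neg_one] at e2
      refine (add_le_add (mul_le_mul_of_nonneg_left e1 (by linarith : 0 ≤ 1 - p))
        (mul_le_mul_of_nonneg_left e2 hp0.le)).trans_eq ?_
      field_simp
      ring

/-- A knockout tournament among the candidates `c 0, …, c (2 ^ l - 1)`: the match between the
winners of the two halves tests the first winner with a number of queries proportional to the
height of the match, and keeps it if it is judged to be `1`. -/
def tournament (m : ℕ) : ℕ → (ℕ → Fin K) → QueryProg K (Fin K)
  | 0, c => ret (c 0)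
  | l + 1, c =>
    (tournament m l c).bind fun a =>
      (tournament m l fun i => c (2 ^ l + i)).bind fun b =>
        (majority a (m * (l + 1)) 0).bind fun r => ret (if r then a else b)

theorem exists_depthLE_tournament (m l : ℕ) :
    ∃ d, d + m * (l + 2) = m * 2 ^ (l + 1) ∧
      ∀ c : ℕ → Fin K, (tournament m l c).DepthLE d := by
  induction l with
  | zero => exact ⟨0, by ring, fun c => trivial⟩
  | succ l ih =>
    obtain ⟨d, hd, h⟩ := ih
    refine ⟨d + (d + (m * (l + 1) + 0)), ?_, fun c => ?_⟩
    · rw [pow_succ, ← mul_assoc, ← hd]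
      ring
    · exact (h _).bind fun a => (h _).bind fun b => (depthLE_majority _ _ _).bind fun r => trivial

theorem expect_tournament_le {p : ℝ} (hp0 : 0 < p) (hp1 : p < 1 / 2) (θ : Fin K → Bool)
    (m l : ℕ) (c : ℕ → Fin K) (hc : ∃ i < 2 ^ l, θ (c i) = true) :
    (tournament m l c).expect p θ (fun a => if θ a then 0 else 1) ≤
      ∑ j ∈ Finset.range l, ((1 - (1 - 2 * p) ^ 2 / 2) ^ m) ^ (j + 1) := by
  induction l generalizing c with
  | zero =>
    obtain ⟨i, hi, h⟩ := hc
    obtain rfl : i = 0 := by simpa using hi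
    simp [tournament, expect, h]
  | succ l ih =>
    rw [Finset.sum_range_succ, ← pow_mul]
    have hp1' : p ≤ 1 := by linarith
    set ρ := 1 - (1 - 2 * p) ^ 2 / 2 with hρ
    have hρ0 : 0 ≤ ρ ^ (m * (l + 1)) := pow_nonneg (by nlinarith) _
    have key (a : Fin K) := expect_majority_le hp0 hp1 θ a (m * (l + 1)) 0
    simp only [neg_zero, ite_self, zpow_zero, mul_one, ← hρ] at key
    have le_one (a b : Fin K) : (majority a (m * (l + 1)) 0).expect p θ
        (fun r => if θ (if r then a else b) then 0 else 1) ≤ 1 :=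
      (expect_mono hp0.le hp1' θ _ fun r => by split_ifs <;> norm_num).trans_eq
        (expect_const p θ _ 1)
    have first (a b : Fin K) : (majority a (m * (l + 1)) 0).expect p θ
        (fun r => if θ (if r then a else b) then 0 else 1) ≤
          (if θ a then 0 else 1) + ρ ^ (m * (l + 1)) := by
      by_cases ha : θ a = true
      · rw [if_pos ha, zero_add]
        refine (expect_mono hp0.le hp1' θ _ fun r => ?_).trans (key a)
        cases r <;> simp [ha]
        split_ifs <;> norm_num
      · rw [if_neg ha]
        linarith [le_one a b]
    have second (a b : Fin K) : (majority a (m * (l + 1)) 0).expect p θ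
        (fun r => if θ (if r then a else b) then 0 else 1) ≤
          (if θ b then 0 else 1) + ρ ^ (m * (l + 1)) := by
      by_cases hb : θ b = true
      · rw [if_pos hb, zero_add]
        refine (expect_mono hp0.le hp1' θ _ fun r => ?_).trans (key a)
        cases r <;> cases ha : θ a <;> simp [ha, hb]
      · rw [if_neg hb]
        linarith [le_one a b]
    simp only [tournament, expect_bind, expect]
    obtain ⟨i, hi, h⟩ := hc
    by_cases hil : i < 2 ^ l
    · refine (expect_mono hp0.le hp1' θ _ fun a =>
        (expect_mono hp0.le hp1' θ _ fun b => first a b).trans_eq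
          (expect_const p θ _ _)).trans ?_
      rw [expect_add_const]
      gcongr
      exact ih c ⟨i, hil, h⟩
    · refine (expect_mono hp0.le hp1' θ _ fun a =>
        expect_mono hp0.le hp1' θ _ fun b => second a b).trans ?_
      rw [expect_const, expect_add_const]
      gcongr
      refine ih _ ⟨i - 2 ^ l, by rw [pow_succ] at hi; omega, ?_⟩
      rwa [Nat.add_sub_cancel' (not_lt.mp hil)]

end QueryProg

theorem binEnt_eq_binEntropy_div (p : ℝ) : binEnt p = Real.binEntropy p / Real.log 2 := by
  simp only [binEnt, Real.binEntropy_eq_negMulLog_add_negMulLog_one_sub, Real.negMulLog,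
    Real.logb]
  ring

theorem binEnt_lt_one {p : ℝ} (hp : p ≠ 1 / 2) : binEnt p < 1 := by
  rw [binEnt_eq_binEntropy_div, div_lt_one (Real.log_pos one_lt_two)]
  exact Real.binEntropy_lt_log_two.mpr (by simpa using hp)

theorem one_sub_binEnt_le {p : ℝ} (hp0 : 0 < p) (hp1 : p < 1) :
    1 - binEnt p ≤ 2 * (1 - 2 * p) ^ 2 := by
  have hl : 1 / 2 < Real.log 2 := by linarith [Real.log_two_gt_d9]
  have h1 := Real.log_le_sub_one_of_pos (by linarith : 0 < 2 * p)
  have h2 := Real.log_le_sub_one_of_pos (by linarith : 0 < 2 * (1 - p))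
  rw [Real.log_mul two_ne_zero hp0.ne'] at h1
  rw [Real.log_mul two_ne_zero (by linarith)] at h2
  have h : (1 - binEnt p) * Real.log 2 =
      p * (Real.log 2 + Real.log p) + (1 - p) * (Real.log 2 + Real.log (1 - p)) := by
    simp only [binEnt, Real.logb]
    field_simp
    ring
  have h3 : (1 - binEnt p) * Real.log 2 ≤ (1 - 2 * p) ^ 2 := by
    rw [h]
    nlinarith [mul_le_mul_of_nonneg_left h1 hp0.le,
      mul_le_mul_of_nonneg_left h2 (by linarith : 0 ≤ 1 - p)]
  by_contra! hc
  nlinarith [sq_nonneg (1 - 2 * p)]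

theorem exists_repetitions {p δ : ℝ} (hp0 : 0 < p) (hp1 : p < 1 / 2) (hδ0 : 0 < δ)
    (hδ1 : δ < 1 / 2) :
    ∃ m : ℕ, (1 - (1 - 2 * p) ^ 2 / 2) ^ m ≤ δ / 2 ∧
      (m : ℝ) ≤ 6 * Real.log (1 / δ) / (1 - 2 * p) ^ 2 := by
  have hl : 1 / 2 < Real.log 2 := by linarith [Real.log_two_gt_d9]
  have hL : Real.log 2 ≤ Real.log (1 / δ) :=
    Real.log_le_log two_pos (by rw [le_div_iff₀ hδ0]; linarith)
  set L := Real.log (1 / δ) with hLdef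
  have hε : 0 < (1 - 2 * p) ^ 2 := by
    have : 0 < 1 - 2 * p := by linarith
    positivity
  have hε1 : (1 - 2 * p) ^ 2 ≤ 1 := by nlinarith
  set ε := (1 - 2 * p) ^ 2
  refine ⟨⌈4 * L / ε⌉₊, ?_, ?_⟩
  · have hm := Nat.le_ceil (4 * L / ε)
    set m := ⌈4 * L / ε⌉₊
    rw [div_le_iff₀ hε] at hm
    calc (1 - ε / 2) ^ m ≤ Real.exp (-(ε / 2)) ^ m :=
          pow_le_pow_left₀ (by linarith) (Real.one_sub_le_exp_neg _) _
      _ = Real.exp (-(m * ε / 2)) := by rw [← Real.exp_nat_mul]; ring_nf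
      _ ≤ Real.exp (Real.log (δ / 2)) := by
          rw [Real.exp_le_exp, Real.log_div hδ0.ne' two_ne_zero]
          rw [one_div, Real.log_inv] at hLdef
          linarith
      _ = δ / 2 := Real.exp_log (by linarith)
  · have hL0 : 0 < L := by linarith
    refine (Nat.ceil_lt_add_one (by positivity)).le.trans ?_
    rw [div_add_one hε.ne']
    gcongr
    linarith

/-- Upper bound achieved by the noisy tournament algorithm: there is a universal
constant `C > 0` such that for all `K ≥ 1`, `p ∈ (0,1/2)` and `δ ∈ (0,1/2)` there is
an adaptive algorithm making at most `C·K·ln(1/δ)/(1-H(p))` noisy queries which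
outputs `OR(θ)` correctly with probability at least `1 - 2δ` for every
`θ ∈ {0,1}^K`. -/
theorem or_adaptive_upper_bound :
    ∃ C : ℝ, 0 < C ∧
      ∀ (K : ℕ), 1 ≤ K → ∀ p δ : ℝ, 0 < p → p < 1 / 2 → 0 < δ → δ < 1 / 2 →
        ∃ (T : ℕ) (q : Fin T → (Fin T → Bool) → Fin K) (out : (Fin T → Bool) → Bool),
          (∀ (t : Fin T) (ys ys' : Fin T → Bool),
            (∀ s : Fin T, (s : ℕ) < (t : ℕ) → ys s = ys' s) → q t ys = q t ys') ∧
          (T : ℝ) ≤ C * (K : ℝ) * Real.log (1 / δ) / (1 - binEnt p) ∧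
          ∀ θ : Fin K → Bool, detErrOR K T p q out θ ≤ 2 * δ := by
  refine ⟨48, by norm_num, fun K hK p δ hp0 hp1 hδ0 hδ1 => ?_⟩
  obtain ⟨m, hm, hm'⟩ := exists_repetitions hp0 hp1 hδ0 hδ1
  have hp1' : p ≤ 1 := by linarith
  obtain ⟨l, hl, hl'⟩ : ∃ l : ℕ, K ≤ 2 ^ l ∧ 2 ^ l ≤ 2 * K := by
    refine ⟨Nat.log 2 K + 1, (Nat.lt_pow_succ_log_self one_lt_two K).le, ?_⟩
    have := Nat.pow_log_le_self 2 (by omega : K ≠ 0)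
    rw [pow_succ]
    omega
  obtain ⟨d, hd, hdepth⟩ := QueryProg.exists_depthLE_tournament (K := K) m l
  let c : ℕ → Fin K := fun i => if h : i < K then ⟨i, h⟩ else ⟨0, hK⟩
  obtain ⟨q, out, hq, hsum⟩ := ((hdepth c).bind fun a =>
    QueryProg.depthLE_majority a m 0).exists_strategy ⟨0, hK⟩
  refine ⟨d + m, q, out, hq, ?_, fun θ => ?_⟩
  · have hT : d + m ≤ 4 * K * m := by
      rw [pow_succ] at hd
      nlinarith [Nat.zero_le (m * l)]
    have hε : 0 < (1 - 2 * p) ^ 2 := by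
      have : 0 < 1 - 2 * p := by linarith
      positivity
    have hH : 0 < 1 - binEnt p := by linarith [binEnt_lt_one hp1.ne]
    have hL : 0 ≤ Real.log (1 / δ) := Real.log_nonneg (by rw [le_div_iff₀ hδ0]; linarith)
    calc ((d + m : ℕ) : ℝ) ≤ 4 * K * m := by exact_mod_cast hT
      _ ≤ 4 * K * (6 * Real.log (1 / δ) / (1 - 2 * p) ^ 2) := by gcongr
      _ = 48 * K * Real.log (1 / δ) / (2 * (1 - 2 * p) ^ 2) := by rw [mul_comm 2, ← div_div]; ring
      _ ≤ 48 * K * Real.log (1 / δ) / (1 - binEnt p) := by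
          gcongr
          exact one_sub_binEnt_le hp0 (by linarith)
  · have key (a : Fin K) := QueryProg.expect_majority_le hp0 hp1 θ a m 0
    simp only [neg_zero, ite_self, zpow_zero, mul_one] at key
    rw [detErrOR, hsum p θ fun b => if b = orFun θ then 0 else 1, QueryProg.expect_bind]
    set x := (1 - (1 - 2 * p) ^ 2 / 2) ^ m with hx
    have hx0 : 0 ≤ x := pow_nonneg (by nlinarith) _
    by_cases hθ : ∃ k, θ k = true
    · have hor : orFun θ = true := by simpa [orFun] using hθ
      obtain ⟨k, hk⟩ := hθ
      have htour := QueryProg.expect_tournament_le hp0 hp1 θ m l c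
        ⟨k, k.2.trans_le hl, by simpa [c] using hk⟩
      rw [← hx] at htour
      have hgeom : ∑ j ∈ Finset.range l, x ^ (j + 1) ≤ 2 * x := by
        have h : (∑ j ∈ Finset.range l, x ^ (j + 1)) * (1 - x) = x * (1 - x ^ l) := by
          simp only [pow_succ, ← Finset.sum_mul]
          linear_combination (-x) * geom_sum_mul x l
        have hS : 0 ≤ ∑ j ∈ Finset.range l, x ^ (j + 1) :=
          Finset.sum_nonneg fun j _ => by positivity
        nlinarith [mul_nonneg hx0 (pow_nonneg hx0 l)]
      have hbound (a : Fin K) : (QueryProg.majority a m 0).expect p θ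
          (fun b => if b = orFun θ then 0 else 1) ≤ (if θ a then 0 else 1) + x := by
        by_cases ha : θ a = true
        · simpa [ha, hor] using key a
        · rw [if_neg ha]
          refine (QueryProg.expect_mono (g := fun _ => 1) hp0.le hp1' θ _ fun r => ?_).trans ?_
          · split_ifs <;> norm_num
          · rw [QueryProg.expect_const]
            linarith
      refine (QueryProg.expect_mono hp0.le hp1' θ _ hbound).trans ?_
      rw [QueryProg.expect_add_const]
      linarith
    · have hor : orFun θ = false := by simpa [orFun] using hθ
      have hall (a : Fin K) : θ a = orFun θ := by
        rw [hor]
        by_contra h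
        exact hθ ⟨a, by simpa using h⟩
      refine (QueryProg.expect_mono (g := fun _ => x) hp0.le hp1' θ _ fun a => ?_).trans ?_
      · rw [← hall a]
        exact key a
      · rw [QueryProg.expect_const]
        linarith
end

section
/- For every p ∈ [0,1] with p ≠ 1/2, the ratio (1/2 − p)² / (1 − H(p)) lies in the interval [1/4, 1/2], where at p = 0 and p = 1 the ratio is interpreted with H(0) = H(1) = 0. -/
/-- The power series of `2 (log 2 - h(p))`, with `h` the binary entropy in nats,
around `p = 1 / 2`. -/
theorem hasSum_log_two_sub_binEntropy {p : ℝ} (hp0 : 0 < p) (hp1 : p < 1) :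
    HasSum (fun n : ℕ => (1 - 2 * p) ^ (2 * n + 2) * (1 / ((n + 1) * (2 * n + 1))))
      (2 * (Real.log 2 - Real.binEntropy p)) := by
  have hx : |1 - 2 * p| < 1 := abs_lt.2 ⟨by linarith, by linarith⟩
  have hx2 : |(1 - 2 * p) ^ 2| < 1 := by
    rw [abs_pow]
    exact pow_lt_one₀ (abs_nonneg _) hx two_ne_zero
  have h1 := (Real.hasSum_log_sub_log_of_abs_lt_one hx).mul_left (1 - 2 * p)
  have h2 := Real.hasSum_pow_div_log_of_abs_lt_one hx2
  have ha : 1 + (1 - 2 * p) = 2 * (1 - p) := by ring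
  have hb : 1 - (1 - 2 * p) = 2 * p := by ring
  have hc : 1 - (1 - 2 * p) ^ 2 = (2 * p) * (2 * (1 - p)) := by ring
  have hq : 1 - p ≠ 0 := by linarith
  rw [ha, hb, Real.log_mul two_ne_zero hq, Real.log_mul two_ne_zero hp0.ne'] at h1
  rw [hc, Real.log_mul (by positivity) (mul_ne_zero two_ne_zero hq),
    Real.log_mul two_ne_zero hq, Real.log_mul two_ne_zero hp0.ne'] at h2
  have hval : 2 * (Real.log 2 - Real.binEntropy p) =
      (1 - 2 * p) * (Real.log 2 + Real.log (1 - p) - (Real.log 2 + Real.log p)) -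
        -(Real.log 2 + Real.log p + (Real.log 2 + Real.log (1 - p))) := by
    rw [Real.binEntropy_eq_negMulLog_add_negMulLog_one_sub, Real.negMulLog, Real.negMulLog]
    ring
  rw [hval]
  refine (congrArg (HasSum · _) (funext fun n => ?_)).mpr (h1.sub h2)
  rw [← pow_mul]
  field_simp
  ring

open Filter Topology in
theorem sum_one_div_le_two_mul_log_two (s : Finset ℕ) :
    ∑ n ∈ s, (1 / ((n + 1) * (2 * n + 1)) : ℝ) ≤ 2 * Real.log 2 := by
  have hlim : Tendsto
      (fun p : ℝ => ∑ n ∈ s, (1 - 2 * p) ^ (2 * n + 2) * (1 / ((n + 1) * (2 * n + 1)) : ℝ))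
      (𝓝[>] 0) (𝓝 (∑ n ∈ s, (1 / ((n + 1) * (2 * n + 1)) : ℝ))) := by
    have hcont : Continuous (fun p : ℝ =>
        ∑ n ∈ s, (1 - 2 * p) ^ (2 * n + 2) * (1 / ((n + 1) * (2 * n + 1)) : ℝ)) := by
      fun_prop
    simpa using (hcont.tendsto 0).mono_left nhdsWithin_le_nhds
  refine le_of_tendsto hlim ?_
  filter_upwards [Ioo_mem_nhdsGT (zero_lt_one' ℝ)] with p hp
  have hsum := sum_le_hasSum s (fun n _ => mul_nonneg
    (Even.pow_nonneg ⟨n + 1, by ring⟩ (1 - 2 * p)) (by positivity))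
    (hasSum_log_two_sub_binEntropy hp.1 hp.2)
  linarith [Real.binEntropy_nonneg hp.1.le hp.2.le]

theorem sq_le_two_mul_log_two_sub_binEntropy {p : ℝ} (hp0 : 0 < p) (hp1 : p < 1) :
    (1 - 2 * p) ^ 2 ≤ 2 * (Real.log 2 - Real.binEntropy p) := by
  simpa using sum_le_hasSum {0} (fun n _ => mul_nonneg
    (Even.pow_nonneg ⟨n + 1, by ring⟩ (1 - 2 * p)) (by positivity))
    (hasSum_log_two_sub_binEntropy hp0 hp1)

theorem log_two_sub_binEntropy_le {p : ℝ} (hp0 : 0 < p) (hp1 : p < 1) :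
    Real.log 2 - Real.binEntropy p ≤ (1 - 2 * p) ^ 2 * Real.log 2 := by
  have h : 2 * (Real.log 2 - Real.binEntropy p) ≤ (1 - 2 * p) ^ 2 * (2 * Real.log 2) := by
    refine hasSum_le_of_sum_le (hasSum_log_two_sub_binEntropy hp0 hp1) fun s => ?_
    refine le_trans ?_
      (mul_le_mul_of_nonneg_left (sum_one_div_le_two_mul_log_two s) (sq_nonneg (1 - 2 * p)))
    rw [Finset.mul_sum]
    refine Finset.sum_le_sum fun n _ => mul_le_mul_of_nonneg_right ?_ (by positivity)
    have hx : (1 - 2 * p) ^ 2 ≤ 1 := by nlinarith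
    rw [show 2 * n + 2 = 2 * (n + 1) by ring, pow_mul]
    exact pow_le_of_le_one (sq_nonneg _) hx n.succ_ne_zero
  linarith

/-- For every `p ∈ [0,1]` with `p ≠ 1/2`, the ratio `(1/2 - p)² / (1 - H(p))`
lies in the interval `[1/4, 1/2]`. -/
theorem ratio_sq_entropy_mem_Icc (p : ℝ) (hp0 : 0 ≤ p) (hp1 : p ≤ 1) (hp : p ≠ 1 / 2) :
    (1 / 2 - p) ^ 2 / (1 - binEnt p) ∈ Set.Icc (1 / 4 : ℝ) (1 / 2) := by
  rcases hp0.eq_or_lt with rfl | hp0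
  · norm_num [binEnt]
  rcases hp1.eq_or_lt with rfl | hp1
  · norm_num [binEnt]
  have hlog : 0 < Real.log 2 := Real.log_pos one_lt_two
  have hlog1 : Real.log 2 < 1 := by linarith [Real.log_two_lt_d9]
  have hx : 0 < (1 - 2 * p) ^ 2 :=
    sq_pos_of_ne_zero fun h => hp (by linarith)
  have hlower := sq_le_two_mul_log_two_sub_binEntropy hp0 hp1
  have hupper := log_two_sub_binEntropy_le hp0 hp1
  have hmul : (1 - binEnt p) * Real.log 2 = Real.log 2 - Real.binEntropy p := by
    rw [binEnt_eq_binEntropy_div]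
    field_simp
  rw [← hmul] at hlower hupper
  have hle : 1 - binEnt p ≤ (1 - 2 * p) ^ 2 := le_of_mul_le_mul_right hupper hlog
  have hpos : 0 < 1 - binEnt p := pos_of_mul_pos_left (by linarith) hlog.le
  have hge : (1 - 2 * p) ^ 2 ≤ 2 * (1 - binEnt p) := by nlinarith
  rw [Set.mem_Icc, le_div_iff₀ hpos, div_le_iff₀ hpos]
  constructor <;> nlinarith
end

section
/- Let p ∈ (0,1/2), δ ∈ (0,1), and let n be a positive integer with n ≥ 4·ln(1/δ)/(1−2p)². If X ~ Bin(n, p), then P(X ≥ n/2) < δ. -/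
/-- Each upper-half binomial weight is bounded by a power of any `s` with `p ≤ s`, `p q ≤ s ^ 2`. -/
theorem pow_mul_pow_le_pow_of_mul_le_sq {p q s : ℝ} (hp : 0 ≤ p) (hq : 0 ≤ q) (hps : p ≤ s)
    (hpq : p * q ≤ s ^ 2) {n k : ℕ} (hkn : k ≤ n) (hk : n ≤ 2 * k) :
    p ^ k * q ^ (n - k) ≤ s ^ n := by
  obtain ⟨m, rfl⟩ := Nat.exists_eq_add_of_le hkn
  obtain ⟨j, rfl⟩ : ∃ j, k = m + j := Nat.exists_eq_add_of_le (by omega)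
  have hs : 0 ≤ s := hp.trans hps
  rw [Nat.add_sub_cancel_left]
  calc p ^ (m + j) * q ^ m = (p * q) ^ m * p ^ j := by ring
    _ ≤ (s ^ 2) ^ m * s ^ j := by gcongr
    _ = s ^ (m + j + m) := by ring

/-- Chernoff-type bound for the upper half of a binomial distribution. -/
theorem sum_upper_half_binomial_le {p q s : ℝ} (hp : 0 ≤ p) (hq : 0 ≤ q) (hps : p ≤ s)
    (hpq : p * q ≤ s ^ 2) (n : ℕ) :
    ∑ k ∈ Finset.range (n + 1),
        (if (n : ℝ) / 2 ≤ (k : ℝ) then (n.choose k : ℝ) * p ^ k * q ^ (n - k) else 0)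
      ≤ (2 * s) ^ n := by
  have hs : 0 ≤ s := hp.trans hps
  calc _ ≤ ∑ k ∈ Finset.range (n + 1), (n.choose k : ℝ) * s ^ n := by
        refine Finset.sum_le_sum fun k hk => ?_
        have hkn : k ≤ n := Nat.lt_succ_iff.mp (Finset.mem_range.mp hk)
        split_ifs with h
        · have hnk : n ≤ 2 * k := by
            have : (n : ℝ) ≤ 2 * k := by linarith
            exact_mod_cast this
          rw [mul_assoc]
          gcongr
          exact pow_mul_pow_le_pow_of_mul_le_sq hp hq hps hpq hkn hnk
        · positivity
    _ = (2 * s) ^ n := by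
        rw [← Finset.sum_mul, mul_pow]
        congr 1
        exact_mod_cast Nat.sum_range_choose n

/-- If `p ∈ (0,1/2)`, `δ ∈ (0,1)` and `n` is a positive integer with
`n ≥ 4 ln(1/δ)/(1-2p)²`, then for `X ~ Bin(n, p)` one has `P(X ≥ n/2) < δ`.
The probability is written out explicitly as a sum of binomial probabilities. -/
theorem binomial_tail_lt_delta (p δ : ℝ) (hp0 : 0 < p) (hp1 : p < 1 / 2)
    (hδ0 : 0 < δ) (hδ1 : δ < 1) (n : ℕ) (hn : 0 < n)
    (hn2 : 4 * Real.log (1 / δ) / (1 - 2 * p) ^ 2 ≤ (n : ℝ)) :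
    ∑ k ∈ Finset.range (n + 1),
        (if (n : ℝ) / 2 ≤ (k : ℝ) then (n.choose k : ℝ) * p ^ k * (1 - p) ^ (n - k) else 0)
      < δ := by
  have hx : 0 < (1 - 2 * p) ^ 2 := pow_pos (by linarith) 2
  set s : ℝ := Real.exp (-(1 - 2 * p) ^ 2 / 2) / 2 with hs
  have hs0 : 0 < s := by positivity
  have hs2 : s ^ 2 = Real.exp (-(1 - 2 * p) ^ 2) / 4 := by
    rw [hs, div_pow, ← Real.exp_nat_mul]
    norm_num
    ring_nf
  have hpq : p * (1 - p) ≤ s ^ 2 := by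
    have := Real.add_one_le_exp (-(1 - 2 * p) ^ 2)
    rw [hs2]
    linarith
  have hps : p ≤ s := by
    refine le_of_pow_le_pow_left₀ two_ne_zero hs0.le ?_
    nlinarith
  refine (sum_upper_half_binomial_le hp0.le (by linarith) hps hpq n).trans_lt ?_
  have hlog : Real.log δ < 0 := Real.log_neg hδ0 hδ1
  rw [div_le_iff₀ hx, one_div, Real.log_inv] at hn2
  calc (2 * s) ^ n = Real.exp (n * (-(1 - 2 * p) ^ 2 / 2)) := by
        rw [Real.exp_nat_mul, hs, mul_div_cancel₀ _ two_ne_zero]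
    _ < Real.exp (Real.log δ) := Real.exp_lt_exp.mpr (by linarith)
    _ = δ := Real.exp_log hδ0
end

section
/- Let p ∈ (0,1/2), δ ∈ (0,1), K ≥ 1, and let m be a positive integer with m ≥ 4·ln(1/δ)/(1−2p)². Fix l ∈ {0,1,…,K} and let N_1,…,N_K be independent random variables with N_i ~ Bin(m, 1−p) for i ≤ l and N_i ~ Bin(m, p) for i > l. Define S(j) := Σ_{i=1}^{j} N_i + Σ_{i=j+1}^{K} (m − N_i) for j ∈ {0,1,…,K}. Then P( there exists j ≠ l with S(j) ≥ S(l) ) < 2δ/(1−δ). -/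
/-- The score `S(j) = Σ_{i ≤ j} N_i + Σ_{i > j} (m - N_i)` used by the
maximum-likelihood estimator for the non-adaptive noisy `SEARCH` problem.
Indices `i` range over `Fin K` (representing positions `1,…,K`), and
`j ∈ {0,1,…,K}`. -/
def searchScore (K m : ℕ) (N : Fin K → Fin (m + 1)) (j : ℕ) : ℕ :=
  (∑ i ∈ Finset.univ.filter (fun i : Fin K => (i : ℕ) < j), (N i : ℕ)) +
    ∑ i ∈ Finset.univ.filter (fun i : Fin K => ¬ (i : ℕ) < j), (m - (N i : ℕ))

open Finset in
theorem pow_searchScore (K m : ℕ) (N : Fin K → Fin (m + 1)) (j : ℕ) (z : ℝ) :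
    z ^ searchScore K m N j =
      ∏ i : Fin K, if (i : ℕ) < j then z ^ (N i : ℕ) else z ^ (m - (N i : ℕ)) := by
  rw [searchScore, pow_add, prod_ite, prod_pow_eq_pow_sum, prod_pow_eq_pow_sum]

theorem sum_binomial_weight (m : ℕ) (x y : ℝ) :
    ∑ n : Fin (m + 1), (m.choose n : ℝ) * x ^ (n : ℕ) * y ^ (m - (n : ℕ)) = (x + y) ^ m := by
  rw [Fin.sum_univ_eq_sum_range (fun n => (m.choose n : ℝ) * x ^ n * y ^ (m - n)), add_pow]
  exact Finset.sum_congr rfl fun n _ => by ring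

/-- The moment generating factor of a single position. -/
theorem sum_binomial_weight_mul_ratio (m : ℕ) (p z s : ℝ) (hz : 0 < z)
    (hs : (1 - p) * z⁻¹ + p * z = s) (A B : Prop) [Decidable A] [Decidable B] :
    ∑ n : Fin (m + 1), (m.choose n : ℝ) * (if B then 1 - p else p) ^ (n : ℕ) *
        (1 - (if B then 1 - p else p)) ^ (m - (n : ℕ)) *
        ((if A then z ^ (n : ℕ) else z ^ (m - (n : ℕ))) /
          (if B then z ^ (n : ℕ) else z ^ (m - (n : ℕ)))) =
      if (A ↔ B) then 1 else s ^ m := by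
  have hz' := hz.ne'
  by_cases hA : A <;> by_cases hB : B <;> simp only [hA, hB, if_true, if_false, iff_self,
    iff_false, not_true, iff_true]
  · simp only [div_self (pow_ne_zero _ hz'), mul_one, sum_binomial_weight]
    ring_nf
  · rw [← hs, add_comm ((1 - p) * z⁻¹), ← sum_binomial_weight]
    refine Finset.sum_congr rfl fun n _ => ?_
    rw [mul_pow, mul_pow, inv_pow]
    ring
  · rw [← hs, ← sum_binomial_weight]
    refine Finset.sum_congr rfl fun n _ => ?_
    rw [mul_pow, mul_pow, inv_pow, sub_sub_cancel]
    ring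
  · simp only [div_self (pow_ne_zero _ hz'), mul_one, sum_binomial_weight]
    ring_nf

theorem prod_ite_lt_iff_lt (K j l : ℕ) (hj : j ≤ K) (hl : l ≤ K) (c : ℝ) :
    ∏ i : Fin K, (if ((i : ℕ) < j ↔ (i : ℕ) < l) then 1 else c) = c ^ Nat.dist j l := by
  rw [Fin.prod_univ_eq_prod_range (fun i => if (i < j ↔ i < l) then 1 else c),
    Finset.prod_ite, Finset.prod_const_one, one_mul, Finset.prod_const]
  congr 1
  have : (Finset.range K).filter (fun i => ¬ (i < j ↔ i < l)) =
      Finset.Ico (min j l) (max j l) := by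
    ext i
    simp only [Finset.mem_filter, Finset.mem_range, Finset.mem_Ico]
    omega
  rw [this, Nat.card_Ico, Nat.dist]
  omega

theorem sum_pow_dist_le (r : ℝ) (h0 : 0 ≤ r) (h1 : r < 1) (K : ℕ) (l : Fin (K + 1)) :
    ∑ j ∈ Finset.univ.erase l, r ^ Nat.dist j l ≤ 2 * r / (1 - r) := by
  obtain ⟨l, hl⟩ := l
  obtain ⟨n, rfl⟩ : ∃ n, K = l + n := ⟨K - l, by omega⟩
  have hgeom : ∀ n : ℕ, (∑ j ∈ Finset.range n, r ^ (j + 1)) ≤ r / (1 - r) := by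
    intro n
    have h : (∑ j ∈ Finset.range n, r ^ (j + 1)) = r * ∑ j ∈ Finset.range n, r ^ j := by
      rw [Finset.mul_sum]
      exact Finset.sum_congr rfl fun j _ => by ring
    rw [h, le_div_iff₀ (by linarith), mul_assoc, geom_sum_mul_neg]
    nlinarith [pow_nonneg h0 n]
  have hsum : (∑ j : Fin (l + n + 1), r ^ Nat.dist j l) =
      (∑ j ∈ Finset.range l, r ^ (j + 1)) + ((∑ j ∈ Finset.range n, r ^ (j + 1)) + 1) := by
    rw [Fin.sum_univ_eq_sum_range (fun j => r ^ Nat.dist j l), add_assoc, Finset.sum_range_add,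
      Finset.sum_range_succ']
    congr 1
    · rw [← Finset.sum_range_reflect]
      refine Finset.sum_congr rfl fun j hj => ?_
      rw [Finset.mem_range] at hj
      congr 1
      rw [Nat.dist]
      omega
    · simp [Nat.dist]
  rw [Finset.sum_erase_eq_sub (Finset.mem_univ _), hsum, Nat.dist_self, pow_zero]
  have := hgeom l
  have := hgeom n
  have : 2 * r / (1 - r) = r / (1 - r) + r / (1 - r) := by ring
  linarith

theorem exists_chernoff_parameter (p : ℝ) (hp0 : 0 < p) (hp1 : p < 1 / 2) :
    ∃ z s : ℝ, 1 ≤ z ∧ 0 ≤ s ∧ s ^ 2 = 4 * p * (1 - p) ∧ (1 - p) * z⁻¹ + p * z = s := by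
  have hu : 0 < √p := Real.sqrt_pos.2 hp0
  have hv : 0 < √(1 - p) := Real.sqrt_pos.2 (by linarith)
  have hu2 : √p ^ 2 = p := Real.sq_sqrt hp0.le
  have hv2 : √(1 - p) ^ 2 = 1 - p := Real.sq_sqrt (by linarith)
  refine ⟨√(1 - p) / √p, 2 * √p * √(1 - p), ?_, by positivity, ?_, ?_⟩
  · rw [one_le_div hu]
    exact Real.sqrt_le_sqrt (by linarith)
  · rw [mul_pow, mul_pow, hu2, hv2]
    norm_num
  · generalize √p = u at *
    generalize √(1 - p) = v at *
    rw [← hv2, ← hu2]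
    field_simp
    ring

theorem pow_le_sq_of_log_le (p δ s : ℝ) (hp1 : p < 1 / 2) (hδ0 : 0 < δ) (m : ℕ)
    (hm : 4 * Real.log (1 / δ) / (1 - 2 * p) ^ 2 ≤ (m : ℝ)) (hs : s ^ 2 = 4 * p * (1 - p)) :
    s ^ m ≤ δ ^ 2 := by
  have hpos : 0 < (1 - 2 * p) ^ 2 := by
    have : 0 < 1 - 2 * p := by linarith
    positivity
  rw [div_le_iff₀ hpos, one_div, Real.log_inv] at hm
  refine (abs_le_of_sq_le_sq' ?_ (by positivity)).2
  calc (s ^ m) ^ 2 = (4 * p * (1 - p)) ^ m := by rw [← hs]; ring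
    _ ≤ Real.exp (-(1 - 2 * p) ^ 2) ^ m := by
        refine pow_le_pow_left₀ (by nlinarith) ?_ m
        nlinarith [Real.add_one_le_exp (-(1 - 2 * p) ^ 2)]
    _ = Real.exp (-(m * (1 - 2 * p) ^ 2)) := by rw [← Real.exp_nat_mul]; ring_nf
    _ ≤ Real.exp ((4 : ℕ) * Real.log δ) := by
        refine Real.exp_le_exp.2 ?_
        push_cast
        linarith
    _ = (δ ^ 2) ^ 2 := by rw [Real.exp_nat_mul, Real.exp_log hδ0]; ring

/-- Success guarantee of the non-adaptive maximum-likelihood estimator for the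
noisy `SEARCH` problem.  Let `p ∈ (0,1/2)`, `δ ∈ (0,1)`, `K ≥ 1`, and let `m` be
a positive integer with `m ≥ 4 ln(1/δ)/(1-2p)²`.  Fix `l ∈ {0,…,K}` and let
`N_1,…,N_K` be independent with `N_i ~ Bin(m, 1-p)` for `i ≤ l` and
`N_i ~ Bin(m, p)` for `i > l`.  Then the probability that some `j ≠ l` has
`S(j) ≥ S(l)` is less than `2δ/(1-δ)`.  The probability is written out
explicitly as a sum over all outcomes `N : Fin K → {0,…,m}` of the product of
the binomial probabilities, times the indicator of the bad event. -/
theorem search_mle_guarantee (p δ : ℝ) (hp0 : 0 < p) (hp1 : p < 1 / 2)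
    (hδ0 : 0 < δ) (hδ1 : δ < 1) (K : ℕ) (hK : 1 ≤ K) (m : ℕ) (hm : 0 < m)
    (hm2 : 4 * Real.log (1 / δ) / (1 - 2 * p) ^ 2 ≤ (m : ℝ)) (l : Fin (K + 1)) :
    ∑ N : Fin K → Fin (m + 1),
        ((∏ i : Fin K,
            (m.choose (N i) : ℝ) * (if (i : ℕ) < (l : ℕ) then 1 - p else p) ^ (N i : ℕ) *
              (1 - (if (i : ℕ) < (l : ℕ) then 1 - p else p)) ^ (m - (N i : ℕ))) *
          (if ∃ j : Fin (K + 1), j ≠ l ∧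
              searchScore K m N (l : ℕ) ≤ searchScore K m N (j : ℕ) then 1 else 0))
      < 2 * δ / (1 - δ) := by
  obtain ⟨z, s, hz, hs0, hs2, hzs⟩ := exists_chernoff_parameter p hp0 hp1
  have hz0 : 0 < z := by linarith
  have hc := pow_le_sq_of_log_le p δ s hp1 hδ0 m hm2 hs2
  set w : Fin K → Fin (m + 1) → ℝ := fun i n =>
    (m.choose n : ℝ) * (if (i : ℕ) < (l : ℕ) then 1 - p else p) ^ (n : ℕ) *
      (1 - (if (i : ℕ) < (l : ℕ) then 1 - p else p)) ^ (m - (n : ℕ)) with hw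
  set f : Fin (K + 1) → Fin K → Fin (m + 1) → ℝ := fun j i n =>
    (if (i : ℕ) < (j : ℕ) then z ^ (n : ℕ) else z ^ (m - (n : ℕ))) /
      (if (i : ℕ) < (l : ℕ) then z ^ (n : ℕ) else z ^ (m - (n : ℕ))) with hf
  have hw0 : ∀ i n, 0 ≤ w i n := by
    intro i n
    have h1 : 0 ≤ 1 - p := by linarith
    simp only [hw]
    split_ifs
    · rw [sub_sub_cancel]
      positivity
    · positivity
  have hratio : ∀ (N : Fin K → Fin (m + 1)) (j : Fin (K + 1)),
      ∏ i, f j i (N i) = z ^ searchScore K m N j / z ^ searchScore K m N l := by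
    intro N j
    simp only [hf, Finset.prod_div_distrib, pow_searchScore]
  have hind : ∀ N : Fin K → Fin (m + 1),
      (if ∃ j : Fin (K + 1), j ≠ l ∧
        searchScore K m N (l : ℕ) ≤ searchScore K m N (j : ℕ) then (1 : ℝ) else 0) ≤
      ∑ j ∈ Finset.univ.erase l, ∏ i, f j i (N i) := by
    intro N
    have hnonneg : ∀ j, 0 ≤ ∏ i, f j i (N i) := fun j => by rw [hratio]; positivity
    split_ifs with h
    · obtain ⟨j, hj, hle⟩ := h
      calc (1 : ℝ) ≤ ∏ i, f j i (N i) := by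
            rw [hratio, one_le_div (by positivity)]
            exact pow_le_pow_right₀ hz hle
        _ ≤ _ := Finset.single_le_sum (f := fun j => ∏ i, f j i (N i))
            (fun j _ => hnonneg j) (by simpa using hj)
    · exact Finset.sum_nonneg fun j _ => hnonneg j
  have hmgf : ∀ j : Fin (K + 1),
      ∑ N : Fin K → Fin (m + 1), ∏ i, w i (N i) * f j i (N i) = (s ^ m) ^ Nat.dist j l := by
    intro j
    rw [← Fintype.prod_sum (fun i n => w i n * f j i n)]
    simp only [hw, hf, sum_binomial_weight_mul_ratio m p z s hz0 hzs]
    exact prod_ite_lt_iff_lt K j l (by omega) (by omega) _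
  have hδ2 : δ ^ 2 < 1 := by nlinarith
  calc _ ≤ ∑ N : Fin K → Fin (m + 1),
          (∏ i, w i (N i)) * ∑ j ∈ Finset.univ.erase l, ∏ i, f j i (N i) :=
        Finset.sum_le_sum fun N _ => mul_le_mul_of_nonneg_left (hind N)
          (Finset.prod_nonneg fun i _ => hw0 i (N i))
    _ = ∑ j ∈ Finset.univ.erase l, (s ^ m) ^ Nat.dist j l := by
        simp only [Finset.mul_sum, ← Finset.prod_mul_distrib]
        rw [Finset.sum_comm]
        exact Finset.sum_congr rfl fun j _ => hmgf j
    _ ≤ ∑ j ∈ Finset.univ.erase l, (δ ^ 2) ^ Nat.dist j l :=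
        Finset.sum_le_sum fun j _ => pow_le_pow_left₀ (by positivity) hc _
    _ ≤ 2 * δ ^ 2 / (1 - δ ^ 2) := sum_pow_dist_le _ (by positivity) hδ2 K l
    _ < 2 * δ / (1 - δ) := by
        rw [div_lt_div_iff₀ (by linarith) (by linarith)]
        nlinarith [mul_pos hδ0 (sub_pos.2 hδ1)]
end
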